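/- For every j ∈ ℕ there is a constant C_j such that the following holds. Let δ ∈ (0,1/2), and let S₁ ⊆ [N₁] and S₂ ⊆ [N₂] be nonempty sets with |Sᵢ| = σᵢNᵢ for i = 1, 2. Suppose that, for some θ ∈ ℝ/ℤ, we have |𝔼_{s₁∈S₁, s₂∈S₂} e(θ·s₁^j·s₂^j)| ≥ δ. Then either Nᵢ ≤ (σ₁σ₂δ)^{−C_j} for some i ∈ {1,2}, or else there is some q ∈ ℕ with q ≤ (δσ₁σ₂)^{−C_j} and ‖qθ‖_{ℝ/ℤ} ≤ (δσ₁σ₂)^{−C_j}·(N₁N₂)^{−j}. -/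

import Mathlib

noncomputable section

open Finset

/-- `e(x) = exp(2πix)`. -/
def eC (x : ℝ) : ℂ := Complex.exp (2 * Real.pi * Complex.I * x)

/-- Distance to the nearest integer. -/
def dZ (x : ℝ) : ℝ := |x - (round x : ℝ)|

/-- Uniform average of a complex-valued function over a finite set. -/
def avgC {α : Type*} (s : Finset α) (f : α → ℂ) : ℂ := (∑ x ∈ s, f x) / s.card

lemma dZ_le_abs_sub_intCast (x : ℝ) (n : ℤ) : dZ x ≤ |x - n| := round_le x n

lemma dZ_sub_le (x y : ℝ) : dZ (x - y) ≤ dZ x + dZ y := by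
  refine (dZ_le_abs_sub_intCast _ (round x - round y)).trans ?_
  unfold dZ
  push_cast
  rw [show x - y - ((round x : ℝ) - round y) = (x - round x) - (y - round y) by ring]
  exact abs_sub _ _

lemma abs_le_dZ_add_intCast {x : ℝ} (hx : |x| ≤ 1 / 2) (n : ℤ) : |x| ≤ dZ (x + n) := by
  unfold dZ
  rw [round_add_intCast]
  push_cast
  rw [add_sub_add_right_eq_sub]
  rcases eq_or_ne (round x) 0 with h | h
  · simp [h]
  · have h1 : (1 : ℝ) ≤ |(round x : ℝ)| := by exact_mod_cast Int.one_le_abs h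
    have h2 := abs_sub_abs_le_abs_sub (round x : ℝ) x
    rw [abs_sub_comm] at h2
    linarith

lemma norm_eC (x : ℝ) : ‖eC x‖ = 1 := by
  unfold eC
  rw [show (2 * Real.pi * Complex.I * x : ℂ) = ((2 * Real.pi * x : ℝ) : ℂ) * Complex.I by
    push_cast; ring]
  exact Complex.norm_exp_ofReal_mul_I _

lemma eC_add (x y : ℝ) : eC (x + y) = eC x * eC y := by
  unfold eC
  rw [← Complex.exp_add]
  push_cast
  ring_nf

lemma conj_eC (x : ℝ) : (starRingEnd ℂ) (eC x) = eC (-x) := by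
  unfold eC
  rw [← Complex.exp_conj]
  simp [map_ofNat]

lemma eC_intCast (n : ℤ) : eC n = 1 := by
  unfold eC
  rw [Complex.exp_eq_one_iff]
  exact ⟨n, by push_cast; ring⟩

lemma eC_sub (x y : ℝ) : eC (x - y) = eC x * (starRingEnd ℂ) (eC y) := by
  rw [conj_eC, ← eC_add, sub_eq_add_neg]

lemma four_mul_dZ_le_norm_eC_sub_one (x : ℝ) : 4 * dZ x ≤ ‖eC x - 1‖ := by
  set t : ℝ := x - round x with ht
  have hx : eC x = Complex.exp (Complex.I * ((2 * Real.pi * t : ℝ) : ℂ)) := by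
    rw [show x = t + (round x : ℝ) by rw [ht]; ring, eC_add, eC_intCast, mul_one]
    unfold eC
    congr 1
    push_cast
    ring
  have hπ := Real.pi_pos
  have habs : |t| ≤ 1 / 2 := abs_sub_round x
  have hsin := Real.mul_abs_le_abs_sin (x := Real.pi * t) (by
    rw [abs_mul, abs_of_pos hπ]; nlinarith)
  rw [abs_mul, abs_of_pos hπ, ← mul_assoc, div_mul_cancel₀ _ hπ.ne'] at hsin
  rw [hx, Complex.norm_exp_I_mul_ofReal_sub_one, show 2 * Real.pi * t / 2 = Real.pi * t by ring,
    norm_mul, Real.norm_eq_abs, Real.norm_eq_abs, abs_two]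
  change 4 * |t| ≤ _
  linarith

lemma sum_eC_linear_mul (α c : ℝ) (a b : ℤ) :
    dZ α * ‖∑ n ∈ Icc a b, eC (α * n + c)‖ ≤ 1 := by
  rcases lt_or_ge b a with hab | hab
  · simp [Icc_eq_empty_of_lt hab]
  have htel : ∀ k : ℕ, (eC α - 1) * ∑ n ∈ Icc a (a + k), eC (α * n + c) =
      eC (α * (a + k + 1) + c) - eC (α * a + c) := by
    intro k
    induction k with
    | zero =>
      simp only [Nat.cast_zero, add_zero, Icc_self, sum_singleton]
      rw [show α * (a + 1) + c = α + (α * a + c) by ring, eC_add α]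
      ring
    | succ k ih =>
      have hins : Icc a (a + ((k + 1 : ℕ) : ℤ)) = insert (a + k + 1) (Icc a (a + k)) := by
        ext x
        simp only [mem_Icc, mem_insert]
        push_cast
        omega
      rw [hins, sum_insert (by simp), mul_add, ih]
      push_cast
      rw [show α * (a + (k + 1) + 1) + c = α + (α * (a + k + 1) + c) by ring,
        eC_add α]
      ring
  obtain ⟨k, rfl⟩ : ∃ k : ℕ, b = a + k := ⟨(b - a).toNat, by omega⟩
  have h := congrArg norm (htel k)
  rw [norm_mul] at h
  have h2 : ‖eC (α * (a + k + 1) + c) - eC (α * a + c)‖ ≤ 2 := by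
    refine (norm_sub_le _ _).trans ?_
    rw [norm_eC, norm_eC]
    norm_num
  have h3 := mul_le_mul_of_nonneg_right (four_mul_dZ_le_norm_eC_sub_one α)
    (norm_nonneg (∑ n ∈ Icc a (a + (k : ℤ)), eC (α * n + c)))
  linarith

lemma exists_sub_eq_mul_of_card_lt {N : ℕ} {T : Finset ℤ} (hT : T ⊆ Icc (-(N : ℤ)) N) {K m : ℕ}
    (h : 2 * N + 1 + K * m < K * #T) :
    ∃ x ∈ T, ∃ y ∈ T, ∃ k : ℕ, 0 < k ∧ k < K ∧ x - y = k * m := by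
  have hmaps : ∀ p ∈ range K ×ˢ T, p.2 + p.1 * m ∈ Icc (-(N : ℤ)) (N + K * m) := by
    rintro ⟨k, x⟩ hp
    obtain ⟨hk, hx⟩ := mem_product.1 hp
    have hx := mem_Icc.1 (hT hx)
    have hkm : (k : ℤ) * m ≤ K * m := by exact_mod_cast Nat.mul_le_mul_right m (mem_range.1 hk).le
    have hkm0 : (0 : ℤ) ≤ k * m := by positivity
    dsimp only at hx ⊢
    rw [mem_Icc]
    omega
  have hcard : #(Icc (-(N : ℤ)) (N + K * m)) < #(range K ×ˢ T) := by
    rw [card_product, card_range, Int.card_Icc]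
    refine lt_of_eq_of_lt ?_ h
    have : (N + K * m + 1 - -(N : ℤ)) = ((2 * N + 1 + K * m : ℕ) : ℤ) := by push_cast; ring
    rw [this, Int.toNat_natCast]
  obtain ⟨⟨k, x⟩, hp, ⟨l, y⟩, hp', hne, heq⟩ :=
    exists_ne_map_eq_of_card_lt_of_maps_to hcard hmaps
  simp only [mem_product, mem_range] at hp hp'
  dsimp only at heq
  rcases lt_trichotomy k l with hkl | rfl | hkl
  · refine ⟨x, hp.2, y, hp'.2, l - k, by omega, by omega, ?_⟩
    push_cast [hkl.le]
    linarith
  · exact absurd (by rw [add_right_cancel heq]) hne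
  · refine ⟨y, hp'.2, x, hp.2, k - l, by omega, by omega, ?_⟩
    push_cast [hkl.le]
    linarith

lemma exists_common_of_bounded {ι : Type*} {T : Finset ι} (hT : T.Nonempty) {B : ℝ}
    {R : ι → ℕ → Prop} (h : ∀ x ∈ T, ∃ q : ℕ, 0 < q ∧ (q : ℝ) ≤ B ∧ R x q) :
    ∃ q : ℕ, 0 < q ∧ (q : ℝ) ≤ B ∧ ∃ T' ⊆ T, (#T : ℝ) ≤ B * #T' ∧ ∀ x ∈ T', R x q := by
  classical
  choose! f hf0 hfB hfR using h
  have hmaps : ∀ x ∈ T, f x ∈ Icc 1 ⌊B⌋₊ := fun x hx =>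
    mem_Icc.2 ⟨hf0 x hx, Nat.le_floor (hfB x hx)⟩
  obtain ⟨x₀, hx₀⟩ := hT
  have hB : 0 ≤ B := (Nat.cast_nonneg _).trans (hfB x₀ hx₀)
  obtain ⟨q, hq, hle⟩ := exists_max_image (Icc 1 ⌊B⌋₊) (fun q => #{x ∈ T | f x = q})
    ⟨_, hmaps x₀ hx₀⟩
  refine ⟨q, (mem_Icc.1 hq).1, (Nat.le_floor_iff hB).1 (mem_Icc.1 hq).2, {x ∈ T | f x = q},
    filter_subset _ _, ?_, ?_⟩
  · have h1 : #T ≤ ⌊B⌋₊ * #{x ∈ T | f x = q} := by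
      rw [card_eq_sum_card_fiberwise hmaps]
      refine (sum_le_card_nsmul _ _ _ hle).trans ?_
      simp
    calc (#T : ℝ) ≤ (⌊B⌋₊ : ℝ) * #{x ∈ T | f x = q} := by exact_mod_cast h1
      _ ≤ _ := by gcongr; exact Nat.floor_le hB
  · intro x hx
    obtain ⟨hxT, hxq⟩ := mem_filter.1 hx
    exact hxq ▸ hfR x hxT

lemma le_mul_card_filter_of_le_sum {ι : Type*} {T : Finset ι} {v : ι → ℝ} {N V K : ℝ}
    (hV : 0 < V) (hN : 0 ≤ N) (hK : 2 ≤ K) (hT : (#T : ℝ) ≤ 3 * N) (hv : ∀ x ∈ T, v x ≤ V)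
    (hsum : N * V ≤ K ^ 2 * ∑ x ∈ T, v x) :
    N ≤ K ^ 5 * #{x ∈ T | V ≤ K ^ 5 * v x} := by
  have hK0 : 0 < K := by linarith
  have hpt : ∀ x ∈ T, K ^ 5 * v x ≤ (if V ≤ K ^ 5 * v x then K ^ 5 * V else 0) + V := by
    intro x hx
    split_ifs with h
    · have := mul_le_mul_of_nonneg_left (hv x hx) (pow_pos hK0 5).le
      linarith
    · linarith
  have h1 := sum_le_sum hpt
  rw [← mul_sum, sum_add_distrib, ← sum_filter, sum_const, sum_const, nsmul_eq_mul,
    nsmul_eq_mul] at h1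
  have hK3 : 8 ≤ K ^ 3 := by
    have := pow_le_pow_left₀ (by norm_num) hK 3
    linarith
  have h2 : K ^ 3 * (N * V) ≤ K ^ 5 * ∑ x ∈ T, v x := by
    have := mul_le_mul_of_nonneg_left hsum (pow_pos hK0 3).le
    linarith
  have h3 : 8 * (N * V) ≤ K ^ 3 * (N * V) := by gcongr
  have h4 : (#T : ℝ) * V ≤ 3 * N * V := by gcongr
  have h5 : 0 ≤ N * V := by positivity
  refine le_of_mul_le_mul_right ?_ hV
  linarith

lemma exists_dZ_mul_le_of_card {N : ℕ} {T : Finset ℤ} (hT : T ⊆ Icc (-(N : ℤ)) N) {L ε α : ℝ}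
    (hL : 2 ≤ L) (hε : 0 ≤ ε) (hcard : (N : ℝ) ≤ L * #T) (hN : 4 * L ≤ N) (hLε : 96 * L * ε ≤ 1)
    (hα : ∀ h ∈ T, dZ (α * h) ≤ ε) :
    ∃ q : ℕ, 0 < q ∧ (q : ℝ) ≤ 5 * L ∧ dZ (q * α) ≤ 40 * L ^ 2 * ε / N := by
  have hN0 : (0 : ℝ) < N := by linarith
  have hL0 : 0 < L := by linarith
  have hdiff : ∀ x ∈ T, ∀ y ∈ T, dZ (α * ((x - y : ℤ) : ℝ)) ≤ 2 * ε := by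
    intro x hx y hy
    push_cast
    rw [mul_sub]
    exact (dZ_sub_le _ _).trans (by linarith [hα x hx, hα y hy])
  obtain ⟨q, hq0, hqL, hq⟩ : ∃ q : ℕ, 0 < q ∧ (q : ℝ) ≤ 5 * L ∧ dZ (q * α) ≤ 2 * ε := by
    obtain ⟨x, hx, y, hy, k, hk0, hk, hxy⟩ :=
      exists_sub_eq_mul_of_card_lt hT (K := ⌈4 * L⌉₊) (m := 1) (by
        have h1 : 4 * L ≤ ⌈4 * L⌉₊ := Nat.le_ceil _
        have h2 : (⌈4 * L⌉₊ : ℝ) < 4 * L + 1 := Nat.ceil_lt_add_one (by linarith)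
        have h3 : 4 * L * #T ≤ ⌈4 * L⌉₊ * #T := by gcongr
        have : (2 * N + 1 + ⌈4 * L⌉₊ * 1 : ℝ) < ⌈4 * L⌉₊ * #T := by linarith
        exact_mod_cast this)
    refine ⟨k, hk0, ?_, ?_⟩
    · have h2 : (⌈4 * L⌉₊ : ℝ) < 4 * L + 1 := Nat.ceil_lt_add_one (by linarith)
      have h3 : (k : ℝ) ≤ ⌈4 * L⌉₊ := by exact_mod_cast hk.le
      linarith
    · have := hdiff x hx y hy
      rw [hxy] at this
      push_cast at this
      rwa [mul_one, mul_comm] at this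
  refine ⟨q, hq0, hqL, ?_⟩
  set t : ℝ := q * α - round (q * α) with ht
  change |t| ≤ 2 * ε at hq
  change |t| ≤ _
  rcases eq_or_ne t 0 with h0 | h0
  · rw [h0, abs_zero]
    positivity
  have ht0 : 0 < |t| := abs_pos.2 h0
  have hε0 : 0 < ε := by linarith
  set M : ℕ := ⌊2 * ε / |t|⌋₊ + 1 with hM
  have hM1 : 2 * ε < M * |t| := by
    rw [← div_lt_iff₀ ht0, hM]
    exact_mod_cast Nat.lt_floor_add_one _
  have hM2 : M * |t| ≤ 4 * ε := by
    have h1 : (⌊2 * ε / |t|⌋₊ : ℝ) * |t| ≤ 2 * ε := by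
      rw [← le_div_iff₀ ht0]
      exact Nat.floor_le (by positivity)
    rw [hM]
    push_cast
    linarith
  set K : ℕ := ⌊1 / (8 * ε)⌋₊ with hK
  have hε1 : 192 * ε ≤ 1 := by nlinarith
  have hK1 : K * (8 * ε) ≤ 1 := by
    rw [← le_div_iff₀ (by positivity)]
    exact Nat.floor_le (by positivity)
  have hK2 : 1 ≤ K * (16 * ε) := by
    have h1 : 1 / (8 * ε) < K + 1 := Nat.lt_floor_add_one _
    rw [div_lt_iff₀ (by positivity)] at h1
    linarith
  have hcount : K * #T ≤ 2 * N + 1 + K * (q * M) := by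
    by_contra! hlt
    obtain ⟨x, hx, y, hy, k, hk0, hk, hxy⟩ := exists_sub_eq_mul_of_card_lt hT hlt
    have hkK : (k : ℝ) ≤ K := by exact_mod_cast hk.le
    have hk1 : (1 : ℝ) ≤ k := by exact_mod_cast hk0
    have hd := hdiff x hx y hy
    have habs : |k * M * t| = k * (M * |t|) := by
      rw [abs_mul, abs_of_nonneg (by positivity), mul_assoc]
    have hhalf : |k * M * t| ≤ 1 / 2 := by
      rw [habs]
      have : (k : ℝ) * (M * |t|) ≤ K * (4 * ε) := by gcongr
      linarith
    have heq : α * ((x - y : ℤ) : ℝ) = k * M * t + ((k * M * round (q * α) : ℤ) : ℝ) := by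
      rw [hxy, ht]
      push_cast
      ring
    rw [heq] at hd
    have hle := (abs_le_dZ_add_intCast hhalf (k * M * round (q * α))).trans hd
    rw [habs] at hle
    nlinarith
  have hcount' : (K : ℝ) * #T ≤ 2 * N + 1 + K * (q * M) := by exact_mod_cast hcount
  have hK0 : (0 : ℝ) < K := by
    by_contra! h
    nlinarith
  have h6 : 6 * L ≤ K := by
    have : 96 * L * ε ≤ K * 16 * ε := by linarith
    have := le_of_mul_le_mul_right this hε0
    linarith
  have h7 : K * (N : ℝ) ≤ 2 * (K * (L * (q * M))) := by
    have h1 : (K : ℝ) * N ≤ K * (L * #T) := by gcongr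
    have h2 : L * (K * #T) ≤ L * (3 * N + K * (q * M)) := by
      gcongr
      linarith
    have h3 : 6 * L * N ≤ K * N := by gcongr
    linarith
  have h8 : (N : ℝ) ≤ 2 * (L * (q * M)) := by
    refine le_of_mul_le_mul_left ?_ hK0
    linarith
  rw [le_div_iff₀ hN0]
  calc |t| * N ≤ |t| * (2 * (L * (q * M))) := by gcongr
    _ = 2 * L * q * (M * |t|) := by ring
    _ ≤ 2 * L * (5 * L) * (4 * ε) := by gcongr
    _ = 40 * L ^ 2 * ε := by ring

/-- The forward difference `P(X + h) - P(X)`. -/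
def polyDiff (h : ℤ) (P : Polynomial ℝ) : Polynomial ℝ := Polynomial.taylor (h : ℝ) P - P

lemma eval_polyDiff (h : ℤ) (P : Polynomial ℝ) (x : ℝ) :
    (polyDiff h P).eval x = P.eval (x + h) - P.eval x := by
  simp [polyDiff, Polynomial.taylor_eval]

lemma coeff_taylor_of_natDegree_le {P : Polynomial ℝ} {d : ℕ} (hP : P.natDegree ≤ d + 1) (r : ℝ) :
    (Polynomial.taylor r P).coeff d = P.coeff d + (d + 1) * r * P.coeff (d + 1) := by
  have hdeg : (Polynomial.hasseDeriv d P).natDegree ≤ 1 :=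
    (Polynomial.natDegree_hasseDeriv_le P d).trans (by omega)
  rw [Polynomial.taylor_coeff, Polynomial.eval_eq_sum_range' (n := 2) (by omega)]
  simp only [sum_range_succ, range_zero, sum_empty, Polynomial.hasseDeriv_coeff]
  rw [show 1 + d = d + 1 by omega, Nat.choose_succ_self_right]
  simp
  ring

lemma coeff_polyDiff {P : Polynomial ℝ} {d : ℕ} (hP : P.natDegree ≤ d + 1) (h : ℤ) :
    (polyDiff h P).coeff d = (d + 1) * h * P.coeff (d + 1) := by
  rw [polyDiff, Polynomial.coeff_sub, coeff_taylor_of_natDegree_le hP]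
  ring

lemma natDegree_polyDiff_le {P : Polynomial ℝ} {d : ℕ} (hP : P.natDegree ≤ d + 1) (h : ℤ) :
    (polyDiff h P).natDegree ≤ d := by
  rw [Polynomial.natDegree_le_iff_coeff_eq_zero]
  intro n hn
  rw [polyDiff, Polynomial.coeff_sub, coeff_taylor_of_natDegree_le (by omega),
    Polynomial.coeff_eq_zero_of_natDegree_lt (p := P) (n := n + 1) (by omega)]
  ring

/-- Iterated differencing, for a property `Q K P` of a polynomial `P` (where larger `K` is weaker)
that passes to many differences of `P` and constrains polynomials of degree at most `d₀`: the
leading coefficient of a polynomial of degree at most `d₀ + k` with the property is close to a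
rational of small denominator. -/
lemma exists_dZ_mul_coeff_le (d₀ k : ℕ) : ∃ C : ℕ, 1 ≤ C ∧
    ∀ (N : ℕ) (ε : ℝ) (Q : ℝ → Polynomial ℝ → Prop), 1 ≤ N → 0 ≤ ε →
      (∀ K P, 2 ≤ K → P.natDegree ≤ d₀ → Q K P →
        ∃ q : ℕ, 0 < q ∧ (q : ℝ) ≤ K ∧ dZ (q * P.coeff d₀) ≤ K * ε / N ^ d₀) →
      (∀ K P, 2 ≤ K → Q K P → ∃ T ⊆ Icc (-(N : ℤ)) N, (N : ℝ) ≤ K ^ 5 * #T ∧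
        ∀ h ∈ T, Q (K ^ 5) (polyDiff h P)) →
      ∀ K P, 2 ≤ K → P.natDegree ≤ d₀ + k → Q K P → K ^ C ≤ N → K ^ C * ε ≤ N ^ d₀ →
        ∃ q : ℕ, 0 < q ∧ (q : ℝ) ≤ K ^ C ∧ dZ (q * P.coeff (d₀ + k)) ≤ K ^ C * ε / N ^ (d₀ + k) := by
  induction k with
  | zero =>
    refine ⟨1, le_rfl, fun N ε Q _ _ hbase _ K P hK hP hQ _ _ => ?_⟩
    simpa using hbase K P hK hP hQ
  | succ k ih =>
    obtain ⟨C, hC, ih⟩ := ih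
    -- `7` and `6` absorb the numerical constants, `2 ^ 7 ≥ 96` and `2 ^ 6 ≥ 40`
    set A : ℕ := 5 + 5 * C with hA
    refine ⟨3 * A + 7 + (d₀ + k + 1), by omega, ?_⟩
    intro N ε Q hN1 hε hbase hstep K P hK hP hQ hKN hKε
    have hK0 : 0 < K := by linarith
    have hK1 : 1 ≤ K := by linarith
    have hN0 : (0 : ℝ) < N := by exact_mod_cast hN1
    have hN1' : (1 : ℝ) ≤ N := by exact_mod_cast hN1
    have hpow : ∀ {m n : ℕ}, m ≤ n → K ^ m ≤ K ^ n := fun h => pow_le_pow_right₀ hK1 h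
    have htwo : ∀ n : ℕ, (2 : ℝ) ^ n ≤ K ^ n := fun n => pow_le_pow_left₀ (by norm_num) hK n
    obtain ⟨T, hT, hTcard, hTQ⟩ := hstep K P hK hQ
    have hTne : T.Nonempty := by
      rw [← card_pos]
      by_contra! h
      rw [Nat.le_zero.1 h] at hTcard
      simp at hTcard
      omega
    have hK5 : 2 ≤ K ^ 5 := by simpa using hK.trans (by simpa using hpow (show 1 ≤ 5 by norm_num))
    have hP' : P.natDegree ≤ d₀ + k + 1 := hP
    obtain ⟨q, hq0, hqB, T', hT'T, hT'card, hT'⟩ := exists_common_of_bounded hTne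
      (fun h hh => ih N ε Q hN1 hε hbase hstep (K ^ 5) (polyDiff h P) hK5
        (natDegree_polyDiff_le hP' h) (hTQ h hh)
        (by rw [← pow_mul]; exact (hpow (by omega)).trans hKN)
        (by
          rw [← pow_mul]
          exact (mul_le_mul_of_nonneg_right (hpow (by omega)) hε).trans hKε))
    rw [← pow_mul] at hqB hT'card hT'
    set d := d₀ + k with hd
    set E : ℝ := K ^ (5 * C) * ε / N ^ d with hE
    have hE0 : 0 ≤ E := by positivity
    have hEle : E * K ^ (A + 7) ≤ 1 := by
      rw [hE, div_mul_eq_mul_div, div_le_one (by positivity)]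
      calc K ^ (5 * C) * ε * K ^ (A + 7) = K ^ (5 * C + (A + 7)) * ε := by ring
        _ ≤ K ^ (3 * A + 7 + (d + 1)) * ε := 
            mul_le_mul_of_nonneg_right (hpow (by omega)) hε
        _ ≤ N ^ d₀ := hKε
        _ ≤ N ^ d := pow_le_pow_right₀ hN1' (by omega)
    have hL : 2 ≤ K ^ A := by simpa using hK.trans (by simpa using hpow (show 1 ≤ A by omega))
    obtain ⟨r, hr0, hrL, hr⟩ := exists_dZ_mul_le_of_card (N := N) (L := K ^ A) (ε := E)
      (α := q * ((d + 1) * P.coeff (d + 1))) (hT'T.trans hT) hL hE0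
      (by
        refine hTcard.trans ?_
        rw [hA, pow_add, mul_assoc]
        gcongr)
      (by
        have h4 := htwo 2
        calc 4 * K ^ A ≤ K ^ 2 * K ^ A := by gcongr; linarith
          _ = K ^ (2 + A) := by ring
          _ ≤ _ := (hpow (by omega)).trans hKN)
      (by
        have h7 := htwo 7
        calc 96 * K ^ A * E ≤ K ^ 7 * K ^ A * E := by gcongr; linarith
          _ = E * K ^ (A + 7) := by ring
          _ ≤ 1 := hEle)
      (fun h hh => by
        have := hT' h hh
        rw [coeff_polyDiff hP'] at this
        convert this using 2
        ring)
    have hd1 : ((d + 1 : ℕ) : ℝ) ≤ K ^ (d + 1) := by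
      refine le_trans ?_ (htwo (d + 1))
      exact_mod_cast (Nat.lt_two_pow_self).le
    refine ⟨r * q * (d + 1), by positivity, ?_, ?_⟩
    · have h3 := htwo 3
      push_cast at hd1 ⊢
      calc (r : ℝ) * q * (d + 1) ≤ (5 * K ^ A) * K ^ (5 * C) * K ^ (d + 1) := by gcongr
        _ ≤ (K ^ 3 * K ^ A) * K ^ (5 * C) * K ^ (d + 1) := by gcongr; linarith
        _ = K ^ (3 + A + 5 * C + (d + 1)) := by ring
        _ ≤ _ := hpow (by omega)
    · have h6 := htwo 6
      push_cast
      calc dZ (r * q * (d + 1) * P.coeff (d + 1)) = dZ (r * (q * ((d + 1) * P.coeff (d + 1)))) := by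
            ring_nf
        _ ≤ 40 * (K ^ A) ^ 2 * E / N := hr
        _ ≤ K ^ 6 * (K ^ A) ^ 2 * E / N := by gcongr; linarith
        _ = K ^ (6 + 2 * A + 5 * C) * ε / N ^ (d + 1) := by
            rw [hE]
            field_simp
            ring
        _ ≤ _ := by
            rw [← add_assoc]
            exact div_le_div_of_nonneg_right (mul_le_mul_of_nonneg_right (hpow (by omega)) hε)
              (by positivity)

lemma sum_sum_eq_sum_shift {M : Type*} [AddCommMonoid M] {N : ℕ} {A : Finset ℤ}
    (hA : A ⊆ Icc 1 (N : ℤ)) (g : ℤ → ℤ → M) :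
    ∑ y ∈ A, ∑ x ∈ A, g x y = ∑ h ∈ Icc (-(N : ℤ)) N, ∑ n ∈ A with n + h ∈ A, g (n + h) n := by
  simp_rw [sum_filter]
  conv_rhs => rw [sum_comm]
  refine sum_congr rfl fun y hy => ?_
  rw [← sum_filter]
  refine sum_nbij' (fun x => x - y) (fun h => y + h) ?_ ?_ ?_ ?_ ?_
  · intro x hx
    have h1 := mem_Icc.1 (hA hx)
    have h2 := mem_Icc.1 (hA hy)
    rw [mem_filter, mem_Icc, add_sub_cancel]
    exact ⟨by omega, hx⟩
  · intro h hh
    exact (mem_filter.1 hh).2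
  · intro x _
    exact add_sub_cancel y x
  · intro h _
    exact add_sub_cancel_left y h
  · intro x _
    rw [add_sub_cancel]

lemma card_Icc_neg_le {N : ℕ} (hN : 1 ≤ N) : (#(Icc (-(N : ℤ)) N) : ℝ) ≤ 3 * N := by
  rw [Int.card_Icc]
  have : ((N : ℤ) + 1 - -(N : ℤ)).toNat ≤ 3 * N := by omega
  exact_mod_cast this

lemma card_le_of_subset_Icc {N : ℕ} {A : Finset ℤ} (hA : A ⊆ Icc 1 (N : ℤ)) : #A ≤ N := by
  simpa using card_le_card hA

/-- **Weyl's inequality**, inverse form. -/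
lemma exists_dZ_mul_coeff_le_of_le_norm_sum (k : ℕ) : ∃ C : ℕ, 1 ≤ C ∧
    ∀ (N : ℕ) (K : ℝ) (P : Polynomial ℝ), 1 ≤ N → 2 ≤ K → P.natDegree ≤ 1 + k →
      (N : ℝ) ≤ K * ‖∑ n ∈ Icc 1 (N : ℤ), eC (P.eval (n : ℝ))‖ → K ^ C ≤ N →
      ∃ q : ℕ, 0 < q ∧ (q : ℝ) ≤ K ^ C ∧ dZ (q * P.coeff (1 + k)) ≤ K ^ C / N ^ (1 + k) := by
  obtain ⟨C, hC, h⟩ := exists_dZ_mul_coeff_le 1 k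
  refine ⟨C, hC, fun N K P hN hK hP hsum hKN => ?_⟩
  have hN0 : (0 : ℝ) < N := by exact_mod_cast hN
  have := h N 1 (fun K P => ∃ a b : ℤ, Icc a b ⊆ Icc 1 (N : ℤ) ∧
    (N : ℝ) ≤ K * ‖∑ n ∈ Icc a b, eC (P.eval (n : ℝ))‖) hN zero_le_one ?_ ?_ K P hK hP
    ⟨1, N, Subset.rfl, hsum⟩ hKN (by simpa using hKN)
  · simpa using this
  · rintro K P hK hP ⟨a, b, -, hle⟩
    refine ⟨1, one_pos, by norm_num; linarith, ?_⟩
    have hlin : ∀ x : ℝ, P.eval x = P.coeff 1 * x + P.coeff 0 := by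
      intro x
      rw [Polynomial.eval_eq_sum_range' (n := 2) (by omega)]
      simp [sum_range_succ]
      ring
    simp_rw [hlin] at hle
    have h1 := sum_eC_linear_mul (P.coeff 1) (P.coeff 0) a b
    rw [Nat.cast_one, one_mul, mul_one, pow_one, le_div_iff₀ hN0]
    have h2 := mul_le_mul_of_nonneg_left hle (show 0 ≤ dZ (P.coeff 1) from abs_nonneg _)
    have h3 := mul_le_mul_of_nonneg_left h1 (show 0 ≤ K by linarith)
    linarith
  · rintro K P hK ⟨a, b, hab, hle⟩
    set v : ℤ → ℝ := fun h =>
      ‖∑ n ∈ Icc a b with n + h ∈ Icc a b, eC ((polyDiff h P).eval (n : ℝ))‖ with hv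
    have hsq : ‖∑ n ∈ Icc a b, eC (P.eval (n : ℝ))‖ ^ 2 ≤ ∑ h ∈ Icc (-(N : ℤ)) N, v h := by
      rw [← RCLike.norm_conj, sq]
      nth_rw 2 [RCLike.norm_conj]
      rw [← norm_mul, map_sum, sum_mul_sum]
      simp_rw [mul_comm (starRingEnd ℂ _), ← eC_sub]
      rw [sum_sum_eq_sum_shift hab
        (fun x y => eC (P.eval (x : ℝ) - P.eval (y : ℝ)))]
      refine (norm_sum_le _ _).trans (le_of_eq ?_)
      refine sum_congr rfl fun h _ => ?_
      simp only [hv, eval_polyDiff, Int.cast_add]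
    refine ⟨_, filter_subset _ _, le_mul_card_filter_of_le_sum (T := Icc (-(N : ℤ)) N) (v := v)
      hN0 hN0.le hK (card_Icc_neg_le hN) ?_ ?_, ?_⟩
    · intro h _
      refine (norm_sum_le _ _).trans ?_
      simp only [norm_eC, sum_const, nsmul_eq_mul, mul_one]
      exact_mod_cast card_le_of_subset_Icc ((filter_subset _ _).trans hab)
    · calc (N : ℝ) * N ≤ (K * ‖∑ n ∈ Icc a b, eC (P.eval (n : ℝ))‖) *
            (K * ‖∑ n ∈ Icc a b, eC (P.eval (n : ℝ))‖) := by gcongr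
        _ = K ^ 2 * ‖∑ n ∈ Icc a b, eC (P.eval (n : ℝ))‖ ^ 2 := by ring
        _ ≤ _ := by gcongr
    · intro h hh
      have hIcc : Icc (max a (a - h)) (min b (b - h)) = {n ∈ Icc a b | n + h ∈ Icc a b} := by
        ext n
        simp only [mem_Icc, mem_filter]
        omega
      refine ⟨max a (a - h), min b (b - h), ?_, ?_⟩
      · rw [hIcc]
        exact (filter_subset _ _).trans hab
      · rw [hIcc]
        exact (mem_filter.1 hh).2

/-- A polynomial taking many values close to integers has leading coefficient close to a rational
of small denominator. -/
lemma exists_dZ_mul_coeff_le_of_card (k : ℕ) : ∃ C : ℕ, 1 ≤ C ∧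
    ∀ (N : ℕ) (K ε : ℝ) (P : Polynomial ℝ) (H : Finset ℤ), 1 ≤ N → 2 ≤ K → 0 ≤ ε →
      P.natDegree ≤ k → H ⊆ Icc 1 (N : ℤ) → (N : ℝ) ≤ K * #H →
      (∀ n ∈ H, dZ (P.eval (n : ℝ)) ≤ K * ε) → K ^ C ≤ N → K ^ C * ε ≤ 1 →
      ∃ q : ℕ, 0 < q ∧ (q : ℝ) ≤ K ^ C ∧ dZ (q * P.coeff k) ≤ K ^ C * ε / N ^ k := by
  obtain ⟨C, hC, h⟩ := exists_dZ_mul_coeff_le 0 k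
  refine ⟨C, hC, fun N K ε P H hN hK hε hP hH hcard hdZ hKN hKε => ?_⟩
  have hN0 : (0 : ℝ) < N := by exact_mod_cast hN
  have := h N ε (fun K P => ∃ H ⊆ Icc 1 (N : ℤ), (N : ℝ) ≤ K * #H ∧
    ∀ n ∈ H, dZ (P.eval (n : ℝ)) ≤ K * ε) hN hε ?_ ?_ K P hK (by omega)
    ⟨H, hH, hcard, hdZ⟩ hKN (by simpa using hKε)
  · simpa using this
  · rintro K P hK hP ⟨H, -, hle, hdZ⟩
    refine ⟨1, one_pos, by norm_num; linarith, ?_⟩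
    obtain ⟨n, hn⟩ : H.Nonempty := by
      rw [← card_pos]
      by_contra! h0
      rw [Nat.le_zero.1 h0] at hle
      simp at hle
      omega
    have := hdZ n hn
    rw [Polynomial.eq_C_of_natDegree_le_zero hP, Polynomial.eval_C] at this
    simpa using this
  · rintro K P hK ⟨H, hH, hle, hdZ⟩
    have hK0 : 0 < K := by linarith
    set v : ℤ → ℝ := fun h => (#{n ∈ H | n + h ∈ H} : ℝ)
    have hsq : (#H : ℝ) ^ 2 = ∑ h ∈ Icc (-(N : ℤ)) N, v h := by
      have := sum_sum_eq_sum_shift hH (fun _ _ => (1 : ℝ))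
      simpa [sq] using this
    refine ⟨_, filter_subset _ _, le_mul_card_filter_of_le_sum (T := Icc (-(N : ℤ)) N) (v := v)
      hN0 hN0.le hK (card_Icc_neg_le hN) ?_ ?_, ?_⟩
    · intro h _
      exact Nat.cast_le.2 (card_le_of_subset_Icc ((filter_subset _ _).trans hH))
    · calc (N : ℝ) * N ≤ (K * #H) * (K * #H) := by gcongr
        _ = K ^ 2 * ∑ h ∈ Icc (-(N : ℤ)) N, v h := by rw [← hsq]; ring
    · intro h hh
      refine ⟨_, (filter_subset _ _).trans hH, (mem_filter.1 hh).2, fun n hn => ?_⟩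
      obtain ⟨hn, hnh⟩ := mem_filter.1 hn
      have h1 := hdZ _ hnh
      have h2 := hdZ _ hn
      rw [Int.cast_add] at h1
      rw [eval_polyDiff]
      have h4 : 2 ^ 4 ≤ K ^ 4 := pow_le_pow_left₀ (by norm_num) hK 4
      have h5 : 2 * (K * ε) ≤ K ^ 4 * (K * ε) := by gcongr; linarith
      exact (dZ_sub_le _ _).trans (by linarith)

lemma exists_norm_sum_sum_sq_le {ι κ : Type*} {S₁ U : Finset ι} {S₂ : Finset κ} (hS : S₁ ⊆ U)
    (hS₂ : S₂.Nonempty) (F : ι → κ → ℂ) :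
    ∃ m ∈ S₂, ‖∑ x ∈ S₁, ∑ y ∈ S₂, F x y‖ ^ 2 ≤
      #S₁ * #S₂ * ∑ y ∈ S₂, ‖∑ x ∈ U, F x y * (starRingEnd ℂ) (F x m)‖ := by
  obtain ⟨m, hm, hmax⟩ := exists_max_image S₂
    (fun m => ∑ y ∈ S₂, ‖∑ x ∈ U, F x y * (starRingEnd ℂ) (F x m)‖) hS₂
  refine ⟨m, hm, ?_⟩
  have hsq : ∀ x, ((‖∑ y ∈ S₂, F x y‖ ^ 2 : ℝ) : ℂ) =
      ∑ m ∈ S₂, ∑ y ∈ S₂, F x y * (starRingEnd ℂ) (F x m) := by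
    intro x
    push_cast
    rw [← Complex.mul_conj', map_sum, sum_mul_sum, sum_comm]
  have hU : ∑ x ∈ U, ‖∑ y ∈ S₂, F x y‖ ^ 2 ≤
      ∑ m ∈ S₂, ∑ y ∈ S₂, ‖∑ x ∈ U, F x y * (starRingEnd ℂ) (F x m)‖ := by
    have h1 : ((∑ x ∈ U, ‖∑ y ∈ S₂, F x y‖ ^ 2 : ℝ) : ℂ) =
        ∑ m ∈ S₂, ∑ y ∈ S₂, ∑ x ∈ U, F x y * (starRingEnd ℂ) (F x m) := by
      rw [Complex.ofReal_sum]
      simp_rw [hsq]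
      rw [sum_comm]
      exact sum_congr rfl fun _ _ => sum_comm
    have h2 := congrArg norm h1
    rw [Complex.norm_real, Real.norm_of_nonneg (by positivity)] at h2
    rw [h2]
    exact (norm_sum_le _ _).trans (sum_le_sum fun _ _ => norm_sum_le _ _)
  calc ‖∑ x ∈ S₁, ∑ y ∈ S₂, F x y‖ ^ 2 ≤ (∑ x ∈ S₁, ‖∑ y ∈ S₂, F x y‖) ^ 2 := by
        gcongr
        exact norm_sum_le _ _
    _ ≤ #S₁ * ∑ x ∈ S₁, ‖∑ y ∈ S₂, F x y‖ ^ 2 := sq_sum_le_card_mul_sum_sq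
    _ ≤ #S₁ * ∑ x ∈ U, ‖∑ y ∈ S₂, F x y‖ ^ 2 := by
        gcongr
    _ ≤ #S₁ * (#S₂ * ∑ y ∈ S₂, ‖∑ x ∈ U, F x y * (starRingEnd ℂ) (F x m)‖) := by
        gcongr
        refine hU.trans ((sum_le_card_nsmul _ _ _ hmax).trans ?_)
        rw [nsmul_eq_mul]
    _ = _ := by ring

lemma exists_dZ_mul_le_of_bilinear_sum (k : ℕ) : ∃ C : ℕ, 1 ≤ C ∧
    ∀ (N₁ N₂ : ℕ) (K θ : ℝ) (S₁ S₂ : Finset ℤ), 1 ≤ N₁ → 1 ≤ N₂ → 2 ≤ K →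
      S₁ ⊆ Icc 1 (N₁ : ℤ) → S₂ ⊆ Icc 1 (N₂ : ℤ) → S₂.Nonempty →
      (N₁ : ℝ) * N₂ ≤
        K * ‖∑ x ∈ S₁, ∑ y ∈ S₂, eC (θ * ((x : ℝ) ^ (1 + k) * (y : ℝ) ^ (1 + k)))‖ →
      K ^ C ≤ N₁ → K ^ C ≤ N₂ →
      ∃ q : ℕ, 0 < q ∧ (q : ℝ) ≤ K ^ C ∧ dZ (q * θ) ≤ K ^ C / ((N₁ : ℝ) * N₂) ^ (1 + k) := by
  obtain ⟨C₁, hC₁, hweyl⟩ := exists_dZ_mul_coeff_le_of_le_norm_sum k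
  obtain ⟨C₂, hC₂, hpoly⟩ := exists_dZ_mul_coeff_le_of_card (1 + k)
  set B : ℕ := 5 + 5 * C₁ with hB
  refine ⟨5 * C₁ + B * C₂, by omega, ?_⟩
  intro N₁ N₂ K θ S₁ S₂ hN₁ hN₂ hK hS₁ hS₂ hne hsum hKN₁ hKN₂
  have hK0 : 0 < K := by linarith
  have hK1 : 1 ≤ K := by linarith
  have hN₁0 : (0 : ℝ) < N₁ := by exact_mod_cast hN₁
  have hN₂0 : (0 : ℝ) < N₂ := by exact_mod_cast hN₂
  have hpow : ∀ {m n : ℕ}, m ≤ n → K ^ m ≤ K ^ n := fun h => pow_le_pow_right₀ hK1 h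
  have hK2 : ∀ {n : ℕ}, 1 ≤ n → 2 ≤ K ^ n := fun h => hK.trans (by simpa using hpow h)
  obtain ⟨m, -, hm⟩ := exists_norm_sum_sum_sq_le hS₁ hne
    (fun x y : ℤ => eC (θ * ((x : ℝ) ^ (1 + k) * (y : ℝ) ^ (1 + k))))
  set c : ℤ → ℝ := fun y => θ * ((y : ℝ) ^ (1 + k) - (m : ℝ) ^ (1 + k)) with hc
  set v : ℤ → ℝ := fun y => ‖∑ n ∈ Icc 1 (N₁ : ℤ),
    eC ((Polynomial.monomial (1 + k) (c y)).eval (n : ℝ))‖ with hv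
  have hcard₁ : (#S₁ : ℝ) ≤ N₁ := by exact_mod_cast card_le_of_subset_Icc hS₁
  have hcard₂ : (#S₂ : ℝ) ≤ N₂ := by exact_mod_cast card_le_of_subset_Icc hS₂
  have hm' : ‖∑ x ∈ S₁, ∑ y ∈ S₂, eC (θ * ((x : ℝ) ^ (1 + k) * (y : ℝ) ^ (1 + k)))‖ ^ 2 ≤
      N₁ * N₂ * ∑ y ∈ S₂, v y := by
    have hv' : ∀ y, v y = ‖∑ x ∈ Icc 1 (N₁ : ℤ),
        eC (θ * ((x : ℝ) ^ (1 + k) * (y : ℝ) ^ (1 + k))) *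
          (starRingEnd ℂ) (eC (θ * ((x : ℝ) ^ (1 + k) * (m : ℝ) ^ (1 + k))))‖ := by
      intro y
      simp only [hv, hc, Polynomial.eval_monomial, ← eC_sub]
      congr 2
      ext x
      congr 1
      ring
    simp_rw [hv']
    refine hm.trans ?_
    gcongr
  have hpop := le_mul_card_filter_of_le_sum (T := S₂) (v := v) hN₁0 hN₂0.le hK
    (by linarith) (fun y _ => by
      refine (norm_sum_le _ _).trans ?_
      simp [norm_eC])
    (by
      have h1 : ((N₁ : ℝ) * N₂) * (N₁ * N₂) ≤ (N₁ * N₂) * (K ^ 2 * ∑ y ∈ S₂, v y) := by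
        refine (mul_le_mul hsum hsum (by positivity) (by positivity)).trans ?_
        have := mul_le_mul_of_nonneg_left hm' (sq_nonneg K)
        linarith
      have := le_of_mul_le_mul_left h1 (by positivity)
      linarith)
  set H := {y ∈ S₂ | (N₁ : ℝ) ≤ K ^ 5 * v y} with hH
  have hHne : H.Nonempty := by
    rw [← card_pos]
    by_contra! h
    rw [Nat.le_zero.1 h] at hpop
    simp at hpop
    omega
  obtain ⟨q, hq0, hqB, H', hH'H, hH'card, hH'⟩ := exists_common_of_bounded hHne
    (fun y hy => hweyl N₁ (K ^ 5) (Polynomial.monomial (1 + k) (c y)) hN₁ (hK2 (by norm_num))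
      (Polynomial.natDegree_monomial_le _) (mem_filter.1 hy).2
      (by rw [← pow_mul]; exact (hpow (by omega)).trans hKN₁))
  rw [← pow_mul] at hqB hH'card hH'
  obtain ⟨r, hr0, hrB, hr⟩ := hpoly N₂ (K ^ B) (1 / N₁ ^ (1 + k))
    (Polynomial.C (q * θ) * (Polynomial.X ^ (1 + k) - Polynomial.C ((m : ℝ) ^ (1 + k)))) H'
    hN₂ (hK2 (by omega)) (by positivity)
    (by
      refine (Polynomial.natDegree_C_mul_le _ _).trans ?_
      rw [Polynomial.natDegree_X_pow_sub_C])
    (hH'H.trans ((filter_subset _ _).trans hS₂))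
    (by
      refine hpop.trans ?_
      rw [hB, pow_add, mul_assoc]
      gcongr)
    (fun n hn => by
      have h1 := hH' n hn
      rw [Polynomial.coeff_monomial, if_pos rfl] at h1
      simp only [Polynomial.eval_mul, Polynomial.eval_C, Polynomial.eval_sub, Polynomial.eval_pow,
        Polynomial.eval_X]
      rw [mul_assoc, mul_one_div]
      exact h1.trans (div_le_div_of_nonneg_right (hpow (by omega)) (by positivity)))
    (by rw [← pow_mul]; exact (hpow (by omega)).trans hKN₂)
    (by
      rw [mul_one_div, div_le_one (by positivity), ← pow_mul]
      refine ((hpow (by omega)).trans hKN₁).trans ?_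
      exact le_self_pow₀ (by exact_mod_cast hN₁) (by omega))
  have hcoeff : (Polynomial.C (q * θ) * (Polynomial.X ^ (1 + k) -
      Polynomial.C ((m : ℝ) ^ (1 + k)))).coeff (1 + k) = q * θ := by
    rw [Polynomial.coeff_C_mul, Polynomial.coeff_sub, Polynomial.coeff_X_pow_self,
      Polynomial.coeff_C, if_neg (by omega), sub_zero, mul_one]
  rw [hcoeff, ← mul_assoc, ← pow_mul] at hr
  rw [← pow_mul] at hrB
  refine ⟨r * q, by positivity, ?_, ?_⟩
  · push_cast
    calc (r : ℝ) * q ≤ K ^ (B * C₂) * K ^ (5 * C₁) := by gcongr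
      _ = _ := by ring
  · push_cast
    refine hr.trans ?_
    rw [mul_one_div, div_div, ← mul_pow]
    exact div_le_div_of_nonneg_right (hpow (by omega)) (by positivity)

/-- Lemma 3.1 of the paper: bilinear exponential sums. -/
theorem bilinear_exponential_sum (j : ℕ) (hj : 1 ≤ j) :
    ∃ C : ℝ, 1 ≤ C ∧
      ∀ (δ θ : ℝ) (N₁ N₂ : ℕ) (S₁ S₂ : Finset ℕ),
        0 < δ → δ < 1 / 2 →
        S₁.Nonempty → S₂.Nonempty →
        S₁ ⊆ Finset.Icc 1 N₁ → S₂ ⊆ Finset.Icc 1 N₂ →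
        ∀ σ₁ σ₂ : ℝ, (S₁.card : ℝ) = σ₁ * N₁ → (S₂.card : ℝ) = σ₂ * N₂ →
        δ ≤ ‖avgC S₁ (fun s₁ => avgC S₂ (fun s₂ =>
              eC (θ * ((s₁ : ℝ) ^ j * (s₂ : ℝ) ^ j))))‖ →
        ((N₁ : ℝ) ≤ (σ₁ * σ₂ * δ) ^ (-C) ∨ (N₂ : ℝ) ≤ (σ₁ * σ₂ * δ) ^ (-C)) ∨
          ∃ q : ℕ, 0 < q ∧ (q : ℝ) ≤ (δ * σ₁ * σ₂) ^ (-C) ∧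
            dZ ((q : ℝ) * θ) ≤ (δ * σ₁ * σ₂) ^ (-C) * ((N₁ : ℝ) * N₂) ^ (-(j : ℝ)) := by
  obtain ⟨k, rfl⟩ := Nat.exists_eq_add_of_le hj
  obtain ⟨C, hC, hmain⟩ := exists_dZ_mul_le_of_bilinear_sum k
  refine ⟨C, by exact_mod_cast hC, ?_⟩
  intro δ θ N₁ N₂ S₁ S₂ hδ0 hδ hne₁ hne₂ hS₁ hS₂ σ₁ σ₂ hσ₁ hσ₂ hsum
  have hdens : ∀ {N : ℕ} {S : Finset ℕ} {σ : ℝ}, S.Nonempty → S ⊆ Icc 1 N →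
      (#S : ℝ) = σ * N → 1 ≤ N ∧ 0 < σ ∧ σ ≤ 1 := by
    intro N S σ hne hS hσ
    have h1 : (0 : ℝ) < #S := by exact_mod_cast hne.card_pos
    have h2 : #S ≤ N := by simpa using card_le_card hS
    have h3 : (#S : ℝ) ≤ N := by exact_mod_cast h2
    have h4 : (0 : ℝ) < N := by linarith
    refine ⟨hne.card_pos.trans_le h2, ?_, ?_⟩
    · exact pos_of_mul_pos_left (hσ ▸ h1) h4.le
    · refine le_of_mul_le_mul_right ?_ h4
      linarith
  obtain ⟨hN₁, hσ₁0, hσ₁1⟩ := hdens hne₁ hS₁ hσ₁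
  obtain ⟨hN₂, hσ₂0, hσ₂1⟩ := hdens hne₂ hS₂ hσ₂
  rw [show δ * σ₁ * σ₂ = σ₁ * σ₂ * δ by ring]
  set η := σ₁ * σ₂ * δ with hη
  have hη0 : 0 < η := by positivity
  have hη2 : η ≤ 1 / 2 := by
    have := mul_le_mul (mul_le_one₀ hσ₁1 hσ₂0.le hσ₂1) hδ.le hδ0.le zero_le_one
    linarith
  have hηC : η ^ (-(C : ℝ)) = η⁻¹ ^ C := by
    rw [Real.rpow_neg hη0.le, Real.rpow_natCast, inv_pow]
  have hN0 : (0 : ℝ) ≤ (N₁ : ℝ) * N₂ := by positivity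
  rw [hηC, Real.rpow_neg hN0, Real.rpow_natCast, ← div_eq_mul_inv]
  refine or_iff_not_imp_left.2 fun hlarge => ?_
  push Not at hlarge
  have hmap : ∀ {N : ℕ} {S : Finset ℕ}, S ⊆ Icc 1 N →
      S.map Nat.castEmbedding ⊆ Icc 1 (N : ℤ) := by
    intro N S hS x hx
    obtain ⟨n, hn, rfl⟩ := mem_map.1 hx
    have := mem_Icc.1 (hS hn)
    rw [Nat.castEmbedding_apply, mem_Icc]
    omega
  refine hmain N₁ N₂ η⁻¹ θ (S₁.map Nat.castEmbedding) (S₂.map Nat.castEmbedding) hN₁ hN₂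
    ?_ (hmap hS₁) (hmap hS₂) (hne₂.map) ?_ hlarge.1.le hlarge.2.le
  · rw [le_inv_comm₀ two_pos hη0]
    linarith
  · have hc₁ : (0 : ℝ) < #S₁ := by exact_mod_cast hne₁.card_pos
    have hc₂ : (0 : ℝ) < #S₂ := by exact_mod_cast hne₂.card_pos
    simp only [avgC, ← sum_div, norm_div, Complex.norm_natCast] at hsum
    rw [div_div, le_div_iff₀ (by positivity)] at hsum
    simp only [sum_map, Nat.castEmbedding_apply, Int.cast_natCast]
    rw [inv_mul_eq_div, le_div_iff₀ hη0]
    refine le_trans (le_of_eq ?_) hsum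
    rw [hσ₁, hσ₂, hη]
    ring
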